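/- Let d ≥ 1 be an integer and m, b, M, β > 0. For every r ∈ (0, R₁) ∪ (R₁, R₂), the function f is twice differentiable at r and f″(r) ≤ −((Mβ/4)r + 2Q) f′(r) − (ζ/4) f(r) · 𝟙_{(0,R₂)}(r) − (ξ/4) f(r) · 𝟙_{(0,R₁)}(r), where 𝟙_I denotes the indicator function of the interval I. -/

import Mathlib

open MeasureTheory Real RealInnerProductSpace

noncomputable section

def Vbar {d : ℕ} (x : EuclideanSpace ℝ (Fin d)) : ℝ := 1 + ‖x‖ ^ 2

def Cc (d : ℕ) (m b β : ℝ) : ℝ := 2 * ((d : ℝ) / β + b) + m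

def S1 (d : ℕ) (m b β : ℝ) : Set (EuclideanSpace ℝ (Fin d) × EuclideanSpace ℝ (Fin d)) :=
  {p | Vbar p.1 + Vbar p.2 ≤ 2 * Cc d m b β / m}

def S2 (d : ℕ) (m b β : ℝ) : Set (EuclideanSpace ℝ (Fin d) × EuclideanSpace ℝ (Fin d)) :=
  {p | Vbar p.1 + Vbar p.2 ≤ 4 * Cc d m b β * (1 + 1 / m)}

def R1 (d : ℕ) (m b β : ℝ) : ℝ := Metric.diam (S1 d m b β)

def R2 (d : ℕ) (m b β : ℝ) : ℝ := Metric.diam (S2 d m b β)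

def kappa (d : ℕ) (m b M β : ℝ) : ℝ :=
  min (1 / 2)
    (2 / (Cc d m b β * β * (Real.exp (2 * R1 d m b β) - 1 - 2 * R1 d m b β)) *
      Real.exp (-(M * β * R1 d m b β ^ 2 / 8)))

def Qk (d : ℕ) (m b M β : ℝ) : ℝ :=
  2 * Real.sqrt (kappa d m b M β - kappa d m b M β ^ 2)

def phi (d : ℕ) (m b M β : ℝ) (r : ℝ) : ℝ :=
  Real.exp (-(M * β / 8) * r ^ 2 - 2 * Qk d m b M β * r)

def Phi (d : ℕ) (m b M β : ℝ) (r : ℝ) : ℝ :=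
  ∫ s in (0:ℝ)..r, phi d m b M β s

def zeta (d : ℕ) (m b M β : ℝ) : ℝ :=
  (∫ s in (0:ℝ)..(R2 d m b β), Phi d m b M β s * (phi d m b M β s)⁻¹)⁻¹

def xi (d : ℕ) (m b M β : ℝ) : ℝ :=
  (∫ s in (0:ℝ)..(R1 d m b β), Phi d m b M β s * (phi d m b M β s)⁻¹)⁻¹

def gfun (d : ℕ) (m b M β : ℝ) (r : ℝ) : ℝ :=
  1 - zeta d m b M β / 4 *
      (∫ s in (0:ℝ)..(min r (R2 d m b β)), Phi d m b M β s * (phi d m b M β s)⁻¹)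
    - xi d m b M β / 4 *
      (∫ s in (0:ℝ)..(min r (R1 d m b β)), Phi d m b M β s * (phi d m b M β s)⁻¹)

def ffun (d : ℕ) (m b M β : ℝ) (r : ℝ) : ℝ :=
  if r < 0 then r else ∫ s in (0:ℝ)..(min r (R2 d m b β)), phi d m b M β s * gfun d m b M β s

theorem isBounded_setOf_Vbar_add_le {d : ℕ} (K : ℝ) :
    Bornology.IsBounded
      {p : EuclideanSpace ℝ (Fin d) × EuclideanSpace ℝ (Fin d) | Vbar p.1 + Vbar p.2 ≤ K} := by
  rw [isBounded_iff_forall_norm_le]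
  refine ⟨K, fun p hp => ?_⟩
  simp only [Set.mem_ofPred_eq, Vbar] at hp
  refine max_le ?_ ?_ <;>
    nlinarith [sq_nonneg (‖p.1‖ - 1), sq_nonneg (‖p.2‖ - 1), sq_nonneg ‖p.1‖, sq_nonneg ‖p.2‖]

theorem R1_nonneg (d : ℕ) (m b β : ℝ) : 0 ≤ R1 d m b β := Metric.diam_nonneg

theorem R2_nonneg (d : ℕ) (m b β : ℝ) : 0 ≤ R2 d m b β := Metric.diam_nonneg

theorem R1_le_R2 (d : ℕ) {m b β : ℝ} (hm : 0 < m) (hb : 0 < b) (hβ : 0 < β) :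
    R1 d m b β ≤ R2 d m b β := by
  refine Metric.diam_mono (fun p hp => ?_) (isBounded_setOf_Vbar_add_le _)
  have hC : 0 ≤ Cc d m b β := by unfold Cc; positivity
  have hCm : 0 ≤ Cc d m b β / m := by positivity
  have h1 : 2 * Cc d m b β / m = 2 * (Cc d m b β / m) := by ring
  have h2 : 4 * Cc d m b β * (1 + 1 / m) = 4 * Cc d m b β + 4 * (Cc d m b β / m) := by ring
  simp only [S1, S2, Set.mem_ofPred_eq] at hp ⊢
  linarith

theorem phi_pos (d : ℕ) (m b M β r : ℝ) : 0 < phi d m b M β r := Real.exp_pos _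

theorem hasDerivAt_phi (d : ℕ) (m b M β r : ℝ) :
    HasDerivAt (phi d m b M β)
      (-(M * β / 4 * r + 2 * Qk d m b M β) * phi d m b M β r) r := by
  have h : HasDerivAt (fun s : ℝ => -(M * β / 8) * s ^ 2 - 2 * Qk d m b M β * s)
      (-(M * β / 4 * r + 2 * Qk d m b M β)) r := by
    refine (((hasDerivAt_pow 2 r).const_mul (-(M * β / 8))).sub
      ((hasDerivAt_id r).const_mul (2 * Qk d m b M β))).congr_deriv ?_
    norm_num
    ring
  exact h.exp.congr_deriv (mul_comm _ _)

theorem continuous_phi (d : ℕ) (m b M β : ℝ) : Continuous (phi d m b M β) := by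
  unfold phi; fun_prop

theorem continuous_Phi (d : ℕ) (m b M β : ℝ) : Continuous (Phi d m b M β) :=
  intervalIntegral.continuous_primitive (continuous_phi d m b M β).intervalIntegrable 0

theorem Phi_nonneg (d : ℕ) (m b M β : ℝ) {r : ℝ} (hr : 0 ≤ r) : 0 ≤ Phi d m b M β r :=
  intervalIntegral.integral_nonneg hr fun s _ => (phi_pos d m b M β s).le

theorem continuous_Phi_mul_inv_phi (d : ℕ) (m b M β : ℝ) :
    Continuous fun s => Phi d m b M β s * (phi d m b M β s)⁻¹ :=
  (continuous_Phi d m b M β).mul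
    ((continuous_phi d m b M β).inv₀ fun s => (phi_pos d m b M β s).ne')

theorem integral_Phi_mul_inv_phi_nonneg (d : ℕ) (m b M β : ℝ) {r : ℝ} (hr : 0 ≤ r) :
    0 ≤ ∫ s in (0:ℝ)..r, Phi d m b M β s * (phi d m b M β s)⁻¹ :=
  intervalIntegral.integral_nonneg hr fun s hs =>
    mul_nonneg (Phi_nonneg d m b M β hs.1) (inv_nonneg.2 (phi_pos d m b M β s).le)

theorem zeta_nonneg (d : ℕ) (m b M β : ℝ) : 0 ≤ zeta d m b M β :=
  inv_nonneg.2 (integral_Phi_mul_inv_phi_nonneg d m b M β (R2_nonneg d m b β))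

theorem xi_nonneg (d : ℕ) (m b M β : ℝ) : 0 ≤ xi d m b M β :=
  inv_nonneg.2 (integral_Phi_mul_inv_phi_nonneg d m b M β (R1_nonneg d m b β))

theorem gfun_le_one (d : ℕ) (m b M β : ℝ) {r : ℝ} (hr : 0 ≤ r) : gfun d m b M β r ≤ 1 := by
  have h1 := mul_nonneg (zeta_nonneg d m b M β)
    (integral_Phi_mul_inv_phi_nonneg d m b M β (le_min hr (R2_nonneg d m b β)))
  have h2 := mul_nonneg (xi_nonneg d m b M β)
    (integral_Phi_mul_inv_phi_nonneg d m b M β (le_min hr (R1_nonneg d m b β)))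
  unfold gfun
  linarith

theorem Continuous.continuous_integral_min {h : ℝ → ℝ} (hh : Continuous h) (R : ℝ) :
    Continuous fun r => ∫ s in (0:ℝ)..(min r R), h s :=
  (intervalIntegral.continuous_primitive hh.intervalIntegrable 0).comp
    (continuous_id.min continuous_const)

theorem Continuous.hasDerivAt_integral_min_of_lt {h : ℝ → ℝ} (hh : Continuous h) {r R : ℝ}
    (hr : r < R) : HasDerivAt (fun r => ∫ s in (0:ℝ)..(min r R), h s) (h r) r := by
  refine (hh.integral_hasStrictDerivAt 0 r).hasDerivAt.congr_of_eventuallyEq ?_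
  filter_upwards [Iio_mem_nhds hr] with x hx
  rw [min_eq_left (le_of_lt hx)]

theorem hasDerivAt_integral_min_of_gt (h : ℝ → ℝ) {r R : ℝ} (hr : R < r) :
    HasDerivAt (fun r => ∫ s in (0:ℝ)..(min r R), h s) 0 r := by
  refine (hasDerivAt_const r (∫ s in (0:ℝ)..R, h s)).congr_of_eventuallyEq ?_
  filter_upwards [Ioi_mem_nhds hr] with x hx
  rw [min_eq_right (le_of_lt hx)]

theorem continuous_gfun (d : ℕ) (m b M β : ℝ) : Continuous (gfun d m b M β) := by
  have h := (continuous_Phi_mul_inv_phi d m b M β).continuous_integral_min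
  exact (continuous_const.sub (continuous_const.mul (h (R2 d m b β)))).sub
    (continuous_const.mul (h (R1 d m b β)))

theorem continuous_phi_mul_gfun (d : ℕ) (m b M β : ℝ) :
    Continuous fun s => phi d m b M β s * gfun d m b M β s :=
  (continuous_phi d m b M β).mul (continuous_gfun d m b M β)

theorem hasDerivAt_ffun (d : ℕ) (m b M β : ℝ) {r : ℝ} (hr : r ∈ Set.Ioo 0 (R2 d m b β)) :
    HasDerivAt (ffun d m b M β) (phi d m b M β r * gfun d m b M β r) r := by
  refine ((continuous_phi_mul_gfun d m b M β).hasDerivAt_integral_min_of_lt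
    hr.2).congr_of_eventuallyEq ?_
  filter_upwards [Ioi_mem_nhds hr.1] with x hx
  exact if_neg (not_lt.2 (le_of_lt hx))

theorem ffun_le_Phi (d : ℕ) (m b M β : ℝ) {r : ℝ} (hr : r ∈ Set.Ioo 0 (R2 d m b β)) :
    ffun d m b M β r ≤ Phi d m b M β r := by
  rw [ffun, if_neg (not_lt.2 hr.1.le), min_eq_left hr.2.le]
  refine intervalIntegral.integral_mono_on hr.1.le
    ((continuous_phi_mul_gfun d m b M β).intervalIntegrable _ _)
    ((continuous_phi d m b M β).intervalIntegrable _ _) fun s hs => ?_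
  exact mul_le_of_le_one_right (phi_pos d m b M β s).le (gfun_le_one d m b M β hs.1)

theorem hasDerivAt_gfun (d : ℕ) (m b M β : ℝ) {r : ℝ} (hr₂ : r < R2 d m b β)
    (hr₁ : r ≠ R1 d m b β) :
    HasDerivAt (gfun d m b M β)
      (-(zeta d m b M β / 4 * (Phi d m b M β r * (phi d m b M β r)⁻¹))
        - xi d m b M β / 4 *
          (Set.Iio (R1 d m b β)).indicator (fun s => Phi d m b M β s * (phi d m b M β s)⁻¹) r)
      r := by
  have hc := continuous_Phi_mul_inv_phi d m b M β
  have h1 : HasDerivAt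
      (fun r => ∫ s in (0:ℝ)..(min r (R1 d m b β)), Phi d m b M β s * (phi d m b M β s)⁻¹)
      ((Set.Iio (R1 d m b β)).indicator
        (fun s => Phi d m b M β s * (phi d m b M β s)⁻¹) r) r := by
    rcases hr₁.lt_or_gt with h | h
    · rw [Set.indicator_of_mem (Set.mem_Iio.2 h)]
      exact hc.hasDerivAt_integral_min_of_lt h
    · rw [Set.indicator_of_notMem (Set.notMem_Iio.2 h.le)]
      exact hasDerivAt_integral_min_of_gt _ h
  have h2 := hc.hasDerivAt_integral_min_of_lt hr₂
  exact ((h2.const_mul (zeta d m b M β / 4)).const_sub 1).sub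
    (h1.const_mul (xi d m b M β / 4))

theorem hasDerivAt_deriv_ffun (d : ℕ) (m b M β : ℝ) {r : ℝ} (hr : r ∈ Set.Ioo 0 (R2 d m b β))
    (hr₁ : r ≠ R1 d m b β) :
    HasDerivAt (deriv (ffun d m b M β))
      (-(M * β / 4 * r + 2 * Qk d m b M β) * deriv (ffun d m b M β) r
        - zeta d m b M β / 4 * Phi d m b M β r
        - xi d m b M β / 4 * (Set.Iio (R1 d m b β)).indicator (Phi d m b M β) r) r := by
  have h := ((hasDerivAt_phi d m b M β r).mul
    (hasDerivAt_gfun d m b M β hr.2 hr₁)).congr_of_eventuallyEq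
      (f₁ := deriv (ffun d m b M β)) (by
        filter_upwards [Ioo_mem_nhds hr.1 hr.2] with x hx
        exact (hasDerivAt_ffun d m b M β hx).deriv)
  refine h.congr_deriv ?_
  rw [(hasDerivAt_ffun d m b M β hr).deriv]
  have hφ := (phi_pos d m b M β r).ne'
  by_cases hlt : r ∈ Set.Iio (R1 d m b β)
  · simp only [Set.indicator_of_mem hlt]
    field_simp
    ring
  · simp only [Set.indicator_of_notMem hlt]
    field_simp
    ring

theorem stmt4 (d : ℕ) (hd : 1 ≤ d) (m b M β : ℝ)
    (hm : 0 < m) (hb : 0 < b) (hM : 0 < M) (hβ : 0 < β)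
    (r : ℝ) (hr : r ∈ Set.Ioo 0 (R1 d m b β) ∪ Set.Ioo (R1 d m b β) (R2 d m b β)) :
    DifferentiableAt ℝ (ffun d m b M β) r ∧
    DifferentiableAt ℝ (deriv (ffun d m b M β)) r ∧
    deriv (deriv (ffun d m b M β)) r ≤
      -(M * β / 4 * r + 2 * Qk d m b M β) * deriv (ffun d m b M β) r
      - zeta d m b M β / 4 * Set.indicator (Set.Ioo 0 (R2 d m b β)) (ffun d m b M β) r
      - xi d m b M β / 4 * Set.indicator (Set.Ioo 0 (R1 d m b β)) (ffun d m b M β) r := by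
  have hR := R1_le_R2 d hm hb hβ
  have hr₂ : r ∈ Set.Ioo 0 (R2 d m b β) := by
    rcases hr with h | h
    · exact ⟨h.1, h.2.trans_le hR⟩
    · exact ⟨(R1_nonneg d m b β).trans_lt h.1, h.2⟩
  have hr₁ : r ≠ R1 d m b β := by
    rcases hr with h | h
    · exact h.2.ne
    · exact h.1.ne'
  have hf := hasDerivAt_deriv_ffun d m b M β hr₂ hr₁
  refine ⟨(hasDerivAt_ffun d m b M β hr₂).differentiableAt, hf.differentiableAt, ?_⟩
  have hle := ffun_le_Phi d m b M β hr₂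
  have hζ := mul_le_mul_of_nonneg_left hle (zeta_nonneg d m b M β)
  have hξ := mul_le_mul_of_nonneg_left hle (xi_nonneg d m b M β)
  rw [hf.deriv, Set.indicator_of_mem hr₂]
  by_cases hlt : r < R1 d m b β
  · rw [Set.indicator_of_mem (Set.mem_Iio.2 hlt),
      Set.indicator_of_mem (show r ∈ Set.Ioo 0 (R1 d m b β) from ⟨hr₂.1, hlt⟩)]
    linarith
  · rw [Set.indicator_of_notMem (show r ∉ Set.Iio (R1 d m b β) from hlt),
      Set.indicator_of_notMem (fun h : r ∈ Set.Ioo 0 (R1 d m b β) => hlt h.2)]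
    linarith

end
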